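/- Assume sup_{i∈ℤ^d} Σ_{j∈ℤ^d} tanh(2|J_{ij}|) < 1. Then there exists δ₀ > 0 such that sup over all finite V ⊂ ℤ^d and all δ ∈ [0,δ₀] of (1/|V|) Var_π[ Σ_{i∈V} φ_i/(1+δφ_i) ] is finite, both for π = π^{PCA} and for π = π̃ (on volume V with parameter δ). -/

import Mathlib

open Finset

section defs

/-- The spin value of a Boolean: `true ↦ 1`, `false ↦ -1`. -/
def spin (b : Bool) : ℝ := if b then 1 else -1

variable {ι : Type*} [Fintype ι] [DecidableEq ι]

/-- The configuration `σ` with the spin at site `j` flipped. -/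
def flipAt (σ : ι → Bool) (j : ι) : ι → Bool := Function.update σ j (!σ j)

/-- `ρ_j(g) = max_σ |g(σ) - g(σ^j)|`. -/
noncomputable def rho (j : ι) (g : (ι → Bool) → ℝ) : ℝ :=
  Finset.univ.sup' Finset.univ_nonempty fun σ => |g σ - g (flipAt σ j)|

/-- Expectation of `g` under the (finitely supported) measure `π`. -/
noncomputable def Emean {α : Type*} [Fintype α] (π g : α → ℝ) : ℝ := ∑ x, π x * g x

/-- Variance of `g` under `π`. -/
noncomputable def Var {α : Type*} [Fintype α] (π g : α → ℝ) : ℝ :=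
  Emean π (fun x => g x ^ 2) - (Emean π g) ^ 2

/-- Covariance of `f` and `g` under `π`. -/
noncomputable def Cov {α : Type*} [Fintype α] (π f g : α → ℝ) : ℝ :=
  Emean π (fun x => f x * g x) - Emean π f * Emean π g

/-- Total variation distance `(1/2) Σ_x |μ(x) - ν(x)|`. -/
noncomputable def tv {α : Type*} [Fintype α] (μ ν : α → ℝ) : ℝ :=
  (1 / 2) * ∑ x, |μ x - ν x|

/-- `h_i(σ) = -Σ_j J_{ij} σ_j`. -/
noncomputable def hfun (J : ι → ι → ℝ) (i : ι) (σ : ι → Bool) : ℝ :=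
  -∑ j, J i j * spin (σ j)

/-- `h_{i,l}(σ) = -Σ_{j ≠ l} J_{ij} σ_j`. -/
noncomputable def hil (J : ι → ι → ℝ) (i l : ι) (σ : ι → Bool) : ℝ :=
  -∑ j ∈ Finset.univ.erase l, J i j * spin (σ j)

/-- `H(σ) = -Σ_{i,j} J_{ij} σ_i σ_j` (equals `-Σ_{i≠j}` since `J_{ii}=0`). -/
noncomputable def Ham (J : ι → ι → ℝ) (σ : ι → Bool) : ℝ :=
  -∑ i, ∑ j, J i j * spin (σ i) * spin (σ j)

/-- The Gibbs measure `π^G(σ) = e^{-H(σ)} / Σ_τ e^{-H(τ)}`. -/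
noncomputable def piG (J : ι → ι → ℝ) (σ : ι → Bool) : ℝ :=
  Real.exp (-Ham J σ) / ∑ τ : ι → Bool, Real.exp (-Ham J τ)

/-- `φ_i(σ) = exp(-2 Σ_j J_{ij} σ_i σ_j)`. -/
noncomputable def phi (J : ι → ι → ℝ) (i : ι) (σ : ι → Bool) : ℝ :=
  Real.exp (-2 * ∑ j, J i j * spin (σ i) * spin (σ j))

/-- `f_δ(σ) = Π_i (1 + δ φ_i(σ))`. -/
noncomputable def fδ (J : ι → ι → ℝ) (δ : ℝ) (σ : ι → Bool) : ℝ :=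
  ∏ i, (1 + δ * phi J i σ)

/-- The PCA stationary measure `π^{PCA}(σ) = π^G(σ) f(σ) / π^G(f)`. -/
noncomputable def piPCA (J : ι → ι → ℝ) (δ : ℝ) (σ : ι → Bool) : ℝ :=
  piG J σ * fδ J δ σ / Emean (piG J) (fδ J δ)

/-- The measure `π̃(σ) = π^G(σ) f(σ)² / π^G(f²)`. -/
noncomputable def piTilde (J : ι → ι → ℝ) (δ : ℝ) (σ : ι → Bool) : ℝ :=
  piG J σ * (fδ J δ σ) ^ 2 / Emean (piG J) (fun τ => (fδ J δ τ) ^ 2)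

/-- `Σ_{i∈V} φ_i/(1 + δ φ_i)`. -/
noncomputable def Gsum (J : ι → ι → ℝ) (δ : ℝ) (σ : ι → Bool) : ℝ :=
  ∑ i, phi J i σ / (1 + δ * phi J i σ)

/-- The conditional probability `π(σ_i = 1 | σ restricted to V∖{i})`. -/
noncomputable def condProb (π : (ι → Bool) → ℝ) (i : ι) (σ : ι → Bool) : ℝ :=
  π (Function.update σ i true) /
    (π (Function.update σ i true) + π (Function.update σ i false))

/-- The Dobrushin coefficient `γ_{ij} = max_σ |π(σ_i=1|σ_{∖i}) - π(σ_i=1|σ^j_{∖i})|`. -/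
noncomputable def dobr (π : (ι → Bool) → ℝ) (i j : ι) : ℝ :=
  Finset.univ.sup' Finset.univ_nonempty fun σ =>
    |condProb π i σ - condProb π i (flipAt σ j)|

/-- `ψ_{i,δ}` from the local-specification computation. -/
noncomputable def psi (J : ι → ι → ℝ) (δ : ℝ) (i : ι) (σ : ι → Bool) : ℝ :=
  (1 / 2) *
    (Real.log ((1 + δ * Real.exp (-2 * hfun J i σ)) / (1 + δ * Real.exp (2 * hfun J i σ))) +
      ∑ l ∈ Finset.univ.erase i,
        Real.log
          ((1 + δ * Real.exp (-2 * J i l * spin (σ l) - 2 * spin (σ l) * hil J i l σ)) /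
            (1 + δ * Real.exp (2 * J i l * spin (σ l) - 2 * spin (σ l) * hil J i l σ))))

/-- The pair Hamiltonian `H(σ,σ') = Σ_i [h_i(σ) σ'_i + q(1 - σ_i σ'_i)]`. -/
noncomputable def Hpair (J : ι → ι → ℝ) (q : ℝ) (σ σ' : ι → Bool) : ℝ :=
  ∑ i, (hfun J i σ * spin (σ' i) + q * (1 - spin (σ i) * spin (σ' i)))

/-- `Z_σ = Σ_τ e^{-H(σ,τ)}`. -/
noncomputable def Zconf (J : ι → ι → ℝ) (q : ℝ) (σ : ι → Bool) : ℝ :=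
  ∑ τ : ι → Bool, Real.exp (-Hpair J q σ τ)

/-- The PCA transition probability `P^{PCA}_{σ,σ'} = e^{-H(σ,σ')}/Z_σ`. -/
noncomputable def Ppca (J : ι → ι → ℝ) (q : ℝ) (σ σ' : ι → Bool) : ℝ :=
  Real.exp (-Hpair J q σ σ') / Zconf J q σ

/-- The PCA stationary measure written as `π^{PCA}(σ) = Z_σ / Σ_τ Z_τ`. -/
noncomputable def piPCAq (J : ι → ι → ℝ) (q : ℝ) (σ : ι → Bool) : ℝ :=
  Zconf J q σ / ∑ τ : ι → Bool, Zconf J q τ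

end defs

/-- Restriction of an interaction on an infinite site space to a finite volume `V`. -/
def Jres {α : Type*} (J : α → α → ℝ) (V : Finset α) : ↥V → ↥V → ℝ :=
  fun a b => J a.1 b.1

section elementary

lemma exp_sub_exp_le_mul {x y M : ℝ} (hx : x ≤ M) (hy : y ≤ M) :
    |Real.exp x - Real.exp y| ≤ Real.exp M * |x - y| := by
  wlog h : y ≤ x generalizing x y
  · rw [abs_sub_comm, abs_sub_comm x y]
    exact this hy hx (le_of_not_ge h)
  rw [abs_of_nonneg (sub_nonneg.2 (Real.exp_le_exp.2 h)), abs_of_nonneg (sub_nonneg.2 h)]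
  have h1 : Real.exp y = Real.exp x * Real.exp (y - x) := by rw [← Real.exp_add]; ring_nf
  have h2 := Real.add_one_le_exp (y - x)
  calc Real.exp x - Real.exp y ≤ Real.exp x * (x - y) := by
        rw [h1]; nlinarith [Real.exp_pos x]
    _ ≤ _ := mul_le_mul_of_nonneg_right (Real.exp_le_exp.2 hx) (sub_nonneg.2 h)

lemma log_sub_log_le {x y : ℝ} (hx : 0 < x) (hy : 1 ≤ y) :
    Real.log x - Real.log y ≤ |x - y| := by
  have hy0 : 0 < y := by linarith
  rw [← Real.log_div hx.ne' hy0.ne']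
  refine (Real.log_le_sub_one_of_pos (div_pos hx hy0)).trans ?_
  rw [div_sub_one hy0.ne', div_le_iff₀ hy0]
  nlinarith [le_abs_self (x - y), abs_nonneg (x - y)]

lemma abs_log_sub_log_le {x y : ℝ} (hx : 1 ≤ x) (hy : 1 ≤ y) :
    |Real.log x - Real.log y| ≤ |x - y| := by
  refine abs_sub_le_iff.2 ⟨log_sub_log_le (by linarith) hy, ?_⟩
  rw [abs_sub_comm]
  exact log_sub_log_le (by linarith) hx

/-- The logistic function contracts distances by the sharp `tanh` modulus. -/
lemma logistic_sub_le_tanh (x y : ℝ) :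
    |1 / (1 + Real.exp (-x)) - 1 / (1 + Real.exp (-y))| ≤ Real.tanh (|x - y| / 4) := by
  wlog h : y ≤ x generalizing x y
  · rw [abs_sub_comm, abs_sub_comm x y]
    exact this y x (le_of_not_ge h)
  rw [abs_of_nonneg (sub_nonneg.2 h)]
  obtain ⟨a, ha⟩ : ∃ a, a = Real.exp (-y / 2) := ⟨_, rfl⟩
  obtain ⟨b, hb⟩ : ∃ b, b = Real.exp (-x / 2) := ⟨_, rfl⟩
  have ha0 : 0 < a := ha ▸ Real.exp_pos _
  have hb0 : 0 < b := hb ▸ Real.exp_pos _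
  have hab : b ≤ a := by rw [ha, hb]; exact Real.exp_le_exp.2 (by linarith)
  have hx : Real.exp (-x) = b ^ 2 := by rw [hb, ← Real.exp_nat_mul]; ring_nf
  have hy : Real.exp (-y) = a ^ 2 := by rw [ha, ← Real.exp_nat_mul]; ring_nf
  have ht : Real.tanh ((x - y) / 4) = (a - b) / (a + b) := by
    have e1 : a = Real.exp (-(x + y) / 4) * Real.exp ((x - y) / 4) := by
      rw [ha, ← Real.exp_add]; ring_nf
    have e2 : b = Real.exp (-(x + y) / 4) * Real.exp (-((x - y) / 4)) := by
      rw [hb, ← Real.exp_add]; ring_nf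
    rw [Real.tanh_eq, e1, e2, ← mul_sub, ← mul_add,
      mul_div_mul_left _ _ (Real.exp_pos _).ne']
  have hdiff : 1 / (1 + b ^ 2) - 1 / (1 + a ^ 2) =
      (a - b) * (a + b) / ((1 + a ^ 2) * (1 + b ^ 2)) := by
    field_simp; ring
  rw [hx, hy, ht, hdiff, abs_of_nonneg (div_nonneg (mul_nonneg (by linarith) (by linarith))
    (by positivity)), div_le_div_iff₀ (by positivity) (by positivity)]
  nlinarith [mul_nonneg (sub_nonneg.2 hab) (sq_nonneg (1 - a * b))]

lemma tanh_nonneg_of_nonneg {x : ℝ} (hx : 0 ≤ x) : 0 ≤ Real.tanh x := by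
  rw [Real.tanh_eq_sinh_div_cosh]
  exact div_nonneg (Real.sinh_nonneg_iff.2 hx) (Real.cosh_pos x).le

lemma tanh_le_two_mul {x : ℝ} (hx : 0 ≤ x) : Real.tanh x ≤ 2 * x := by
  have h1 : Real.exp (-x) = Real.exp x * Real.exp (-(2 * x)) := by rw [← Real.exp_add]; ring_nf
  have h2 := Real.add_one_le_exp (-(2 * x))
  have h3 := Real.exp_pos (-(2 * x))
  rw [Real.tanh_eq, h1, ← mul_one_sub, ← mul_one_add,
    mul_div_mul_left _ _ (Real.exp_pos _).ne', div_le_iff₀ (by linarith)]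
  nlinarith [mul_nonneg hx h3.le]

/-- Second difference of `x ↦ log (1 + t e^{-2x})`. -/
lemma log_second_difference_le {t B x α β a b : ℝ} (ht : 0 ≤ t) (hx : |x| ≤ B)
    (hα : |α| ≤ 2 * a) (hβ : |β| ≤ 2 * b) (ha : a ≤ B) (hb : b ≤ B) :
    |(Real.log (1 + t * Real.exp (-2 * (x + α + β))) - Real.log (1 + t * Real.exp (-2 * (x + β))))
      - (Real.log (1 + t * Real.exp (-2 * (x + α))) - Real.log (1 + t * Real.exp (-2 * x)))|
      ≤ t * (16 * Real.exp (10 * B)) * (a * b) := by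
  have key : ∀ {γ c : ℝ}, |γ| ≤ 2 * c → c ≤ B →
      |Real.exp (-2 * γ) - 1| ≤ Real.exp (4 * B) * (4 * c) := by
    intro γ c h1 h2
    have h3 := abs_le.1 h1
    have h := exp_sub_exp_le_mul (x := -2 * γ) (y := 0) (M := 4 * B) (by linarith)
      (by linarith [abs_nonneg γ])
    rw [Real.exp_zero, sub_zero, abs_mul] at h
    refine h.trans (mul_le_mul_of_nonneg_left ?_ (Real.exp_pos _).le)
    norm_num; linarith
  obtain ⟨A, hA⟩ : ∃ A, A = Real.exp (-2 * x) := ⟨_, rfl⟩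
  obtain ⟨P, hP⟩ : ∃ P, P = Real.exp (-2 * α) := ⟨_, rfl⟩
  obtain ⟨Q, hQ⟩ : ∃ Q, Q = Real.exp (-2 * β) := ⟨_, rfl⟩
  have hA0 : 0 < A := hA ▸ Real.exp_pos _
  have hP0 : 0 < P := hP ▸ Real.exp_pos _
  have hQ0 : 0 < Q := hQ ▸ Real.exp_pos _
  have e1 : Real.exp (-2 * (x + α + β)) = A * P * Q := by
    rw [hA, hP, hQ, ← Real.exp_add, ← Real.exp_add]; ring_nf
  have e2 : Real.exp (-2 * (x + α)) = A * P := by rw [hA, hP, ← Real.exp_add]; ring_nf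
  have e3 : Real.exp (-2 * (x + β)) = A * Q := by rw [hA, hQ, ← Real.exp_add]; ring_nf
  rw [e1, e2, e3, ← hA]
  have hAPQ : 0 ≤ t * (A * P * Q) := by positivity
  have hAP : 0 ≤ t * (A * P) := by positivity
  have hAQ : 0 ≤ t * (A * Q) := by positivity
  have hAt : 0 ≤ t * A := by positivity
  have hlog : (Real.log (1 + t * (A * P * Q)) - Real.log (1 + t * (A * Q)))
      - (Real.log (1 + t * (A * P)) - Real.log (1 + t * A)) =
      Real.log ((1 + t * (A * P * Q)) * (1 + t * A)) -
        Real.log ((1 + t * (A * P)) * (1 + t * (A * Q))) := by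
    rw [Real.log_mul (by positivity) (by positivity), Real.log_mul (by positivity) (by positivity)]
    ring
  rw [hlog]
  refine (abs_log_sub_log_le (by nlinarith) (by nlinarith)).trans ?_
  have hdiff : (1 + t * (A * P * Q)) * (1 + t * A) - (1 + t * (A * P)) * (1 + t * (A * Q)) =
      t * A * ((P - 1) * (Q - 1)) := by ring
  have hA1 : A ≤ Real.exp (2 * B) := by
    rw [hA]; exact Real.exp_le_exp.2 (by linarith [abs_le.1 hx])
  have hPQ : |P - 1| * |Q - 1| ≤ (Real.exp (4 * B) * (4 * a)) * (Real.exp (4 * B) * (4 * b)) :=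
    mul_le_mul (hP ▸ key hα ha) (hQ ▸ key hβ hb) (abs_nonneg _)
      ((abs_nonneg _).trans (key hα ha))
  have hexp : Real.exp (10 * B) = Real.exp (2 * B) * Real.exp (4 * B) * Real.exp (4 * B) := by
    rw [← Real.exp_add, ← Real.exp_add]; ring_nf
  rw [hdiff, abs_mul, abs_of_nonneg hAt, abs_mul, hexp]
  calc t * A * (|P - 1| * |Q - 1|)
      ≤ t * Real.exp (2 * B) * ((Real.exp (4 * B) * (4 * a)) * (Real.exp (4 * B) * (4 * b))) :=
        mul_le_mul (mul_le_mul_of_nonneg_left hA1 ht) hPQ (by positivity) (by positivity)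
    _ = _ := by ring

end elementary

section dobrushin

variable {ι : Type*} [DecidableEq ι]

lemma flipAt_flipAt (σ : ι → Bool) (j : ι) : flipAt (flipAt σ j) j = σ := by
  simp [flipAt]

/-- Conditional expectation of `g` given all spins except the one at `i`. -/
noncomputable def heatBath (π : (ι → Bool) → ℝ) (i : ι) (g : (ι → Bool) → ℝ) (σ : ι → Bool) : ℝ :=
  condProb π i σ * g (Function.update σ i true) +
    (1 - condProb π i σ) * g (Function.update σ i false)

lemma heatBath_eq {π : (ι → Bool) → ℝ} (hπ : ∀ σ, 0 < π σ) (i : ι) (g : (ι → Bool) → ℝ)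
    (σ : ι → Bool) :
    heatBath π i g σ =
      (π σ * g σ + π (flipAt σ i) * g (flipAt σ i)) / (π σ + π (flipAt σ i)) := by
  have hne : π (Function.update σ i true) + π (Function.update σ i false) ≠ 0 :=
    (add_pos (hπ _) (hπ _)).ne'
  have hmean : heatBath π i g σ =
      (π (Function.update σ i true) * g (Function.update σ i true) +
        π (Function.update σ i false) * g (Function.update σ i false)) /
      (π (Function.update σ i true) + π (Function.update σ i false)) := by
    unfold heatBath condProb
    rw [one_sub_div hne, add_sub_cancel_left, add_div]
    ring
  rw [hmean]
  cases h : σ i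
  · have e : Function.update σ i false = σ := by rw [← h]; simp
    have e' : flipAt σ i = Function.update σ i true := by simp [flipAt, h]
    rw [e', e, add_comm, add_comm (π σ)]
  · have e : Function.update σ i true = σ := by rw [← h]; simp
    have e' : flipAt σ i = Function.update σ i false := by simp [flipAt, h]
    rw [e', e]

lemma heatBath_flipAt_self (π : (ι → Bool) → ℝ) (i : ι) (g : (ι → Bool) → ℝ) (σ : ι → Bool) :
    heatBath π i g (flipAt σ i) = heatBath π i g σ := by
  simp [heatBath, condProb, flipAt]

lemma flipAt_update_comm {i j : ι} (h : j ≠ i) (σ : ι → Bool) (b : Bool) :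
    Function.update (flipAt σ j) i b = flipAt (Function.update σ i b) j := by
  simp [flipAt, Function.update_comm h, Function.update_of_ne h]

lemma heatBath_flipAt_le {π : (ι → Bool) → ℝ} (hπ : ∀ σ, 0 < π σ) {i j : ι} (hij : j ≠ i)
    {g : (ι → Bool) → ℝ} {r : ι → ℝ} (hg : ∀ j σ, |g σ - g (flipAt σ j)| ≤ r j) {c : ℝ}
    (hc : ∀ σ, |condProb π i σ - condProb π i (flipAt σ j)| ≤ c) (σ : ι → Bool) :
    |heatBath π i g σ - heatBath π i g (flipAt σ j)| ≤ r j + c * r i := by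
  have h1 := hπ (Function.update σ i true)
  have h2 := hπ (Function.update σ i false)
  have hp0 : 0 ≤ condProb π i σ := by unfold condProb; positivity
  have hp1 : 0 ≤ 1 - condProb π i σ := by
    unfold condProb
    rw [one_sub_div (by positivity)]
    have : 0 ≤ π (Function.update σ i true) + π (Function.update σ i false) -
      π (Function.update σ i true) := by linarith
    positivity
  have hi : |g (Function.update (flipAt σ j) i true) - g (Function.update (flipAt σ j) i false)|
      ≤ r i := by
    have := hg i (Function.update (flipAt σ j) i true)
    simpa [flipAt] using this
  have ht := hg j (Function.update σ i true)
  have hf := hg j (Function.update σ i false)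
  rw [← flipAt_update_comm hij] at ht hf
  have hcσ := hc σ
  unfold heatBath
  generalize condProb π i σ = p at *
  generalize condProb π i (flipAt σ j) = p' at *
  generalize g (Function.update σ i true) = a at *
  generalize g (Function.update σ i false) = b at *
  generalize g (Function.update (flipAt σ j) i true) = a' at *
  generalize g (Function.update (flipAt σ j) i false) = b' at *
  have e : p * a + (1 - p) * b - (p' * a' + (1 - p') * b') =
    p * (a - a') + (1 - p) * (b - b') + (p - p') * (a' - b') := by ring
  rw [e]
  have hsum := abs_add_three (p * (a - a')) ((1 - p) * (b - b')) ((p - p') * (a' - b'))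
  rw [abs_mul, abs_mul, abs_mul, abs_of_nonneg hp0, abs_of_nonneg hp1] at hsum
  have := mul_le_mul hcσ hi (abs_nonneg _) ((abs_nonneg _).trans hcσ)
  nlinarith [mul_le_mul_of_nonneg_left ht hp0, mul_le_mul_of_nonneg_left hf hp1]

variable [Fintype ι]

lemma sum_comp_flipAt (i : ι) (F : (ι → Bool) → ℝ) :
    ∑ σ, F (flipAt σ i) = ∑ σ, F σ :=
  Equiv.sum_comp (Function.Involutive.toPerm (fun σ => flipAt σ i) (flipAt_flipAt · i)) F

lemma Emean_mul_sub_heatBath {π : (ι → Bool) → ℝ} (hπ : ∀ σ, 0 < π σ) (i : ι)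
    (f g : (ι → Bool) → ℝ) :
    Emean π (fun σ => f σ * (g σ - heatBath π i g σ)) =
      (1 / 2) * ∑ σ, π σ * π (flipAt σ i) / (π σ + π (flipAt σ i)) *
        ((f σ - f (flipAt σ i)) * (g σ - g (flipAt σ i))) := by
  have h : 2 * Emean π (fun σ => f σ * (g σ - heatBath π i g σ)) =
      ∑ σ, π σ * π (flipAt σ i) / (π σ + π (flipAt σ i)) *
        ((f σ - f (flipAt σ i)) * (g σ - g (flipAt σ i))) := by
    unfold Emean
    rw [two_mul]
    nth_rewrite 2 [← sum_comp_flipAt i]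
    rw [← Finset.sum_add_distrib]
    refine Finset.sum_congr rfl fun σ _ => ?_
    simp only [heatBath_eq hπ, flipAt_flipAt]
    have h1 := hπ σ
    have h2 := hπ (flipAt σ i)
    field_simp
    ring
  linarith

lemma abs_Emean_mul_sub_heatBath_le {π : (ι → Bool) → ℝ} (hπ : ∀ σ, 0 < π σ)
    (hsum : ∑ σ, π σ = 1) (i : ι) {f g : (ι → Bool) → ℝ} {C r : ℝ}
    (hf : ∀ σ, |f σ - f (flipAt σ i)| ≤ C) (hg : ∀ σ, |g σ - g (flipAt σ i)| ≤ r) :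
    |Emean π (fun σ => f σ * (g σ - heatBath π i g σ))| ≤ C * r := by
  have hC : 0 ≤ C := (abs_nonneg _).trans (hf fun _ => true)
  have hr : 0 ≤ r := (abs_nonneg _).trans (hg fun _ => true)
  rw [Emean_mul_sub_heatBath hπ, abs_mul]
  have hb : |∑ σ, π σ * π (flipAt σ i) / (π σ + π (flipAt σ i)) *
        ((f σ - f (flipAt σ i)) * (g σ - g (flipAt σ i)))| ≤ ∑ σ, π σ * (C * r) := by
    refine (Finset.abs_sum_le_sum_abs _ _).trans (Finset.sum_le_sum fun σ _ => ?_)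
    have h1 := hπ σ
    have h2 := hπ (flipAt σ i)
    rw [abs_mul, abs_mul, abs_of_pos (by positivity)]
    refine mul_le_mul ?_ (mul_le_mul (hf σ) (hg σ) (abs_nonneg _) hC) (by positivity) h1.le
    rw [div_le_iff₀ (by positivity)]
    nlinarith
  rw [← Finset.sum_mul, hsum, one_mul] at hb
  rw [abs_of_pos (by norm_num : (0 : ℝ) < 1 / 2)]
  nlinarith [mul_nonneg hC hr]

lemma Emean_heatBath {π : (ι → Bool) → ℝ} (hπ : ∀ σ, 0 < π σ) (i : ι) (g : (ι → Bool) → ℝ) :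
    Emean π (heatBath π i g) = Emean π g := by
  have h := Emean_mul_sub_heatBath hπ i (fun _ => 1) g
  simp only [Emean, one_mul, sub_self, zero_mul, mul_zero, Finset.sum_const_zero, mul_sub,
    Finset.sum_sub_distrib] at h
  unfold Emean
  linarith

lemma abs_Cov_le_heatBath {π : (ι → Bool) → ℝ} (hπ : ∀ σ, 0 < π σ)
    (hsum : ∑ σ, π σ = 1) (i : ι) {f g : (ι → Bool) → ℝ} {C r : ℝ}
    (hf : ∀ σ, |f σ - f (flipAt σ i)| ≤ C) (hg : ∀ σ, |g σ - g (flipAt σ i)| ≤ r) :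
    |Cov π f g| ≤ C * r + |Cov π f (heatBath π i g)| := by
  have h : Cov π f g =
      Emean π (fun σ => f σ * (g σ - heatBath π i g σ)) + Cov π f (heatBath π i g) := by
    unfold Cov
    rw [Emean_heatBath hπ]
    simp only [Emean, mul_sub, Finset.sum_sub_distrib]
    ring
  rw [h]
  exact (abs_add_le _ _).trans
    (add_le_add_left (abs_Emean_mul_sub_heatBath_le hπ hsum i hf hg) _)

lemma abs_sub_le_sum_flipAt {g : (ι → Bool) → ℝ} {r : ι → ℝ}
    (hg : ∀ j σ, |g σ - g (flipAt σ j)| ≤ r j) (σ τ : ι → Bool) :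
    |g σ - g τ| ≤ ∑ j, r j := by
  have key : ∀ S : Finset ι, |g σ - g (S.piecewise τ σ)| ≤ ∑ j ∈ S, r j := by
    intro S
    induction S using Finset.induction_on with
    | empty => simp
    | insert a S ha ih =>
      rw [Finset.sum_insert ha, Finset.piecewise_insert]
      refine (abs_sub_le _ (g (S.piecewise τ σ)) _).trans ?_
      rw [add_comm]
      refine add_le_add ?_ ih
      generalize S.piecewise τ σ = ρ
      by_cases h : τ a = ρ a
      · rw [h, Function.update_eq_self, sub_self, abs_zero]
        exact (abs_nonneg _).trans (hg a ρ)
      · have : Function.update ρ a (τ a) = flipAt ρ a := by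
          rw [flipAt, Bool.eq_not_of_ne h]
        rw [this]
        exact hg a ρ
  simpa using key Finset.univ

lemma abs_Cov_le_crude {π : (ι → Bool) → ℝ} (hπ : ∀ σ, 0 < π σ)
    (hsum : ∑ σ, π σ = 1) (f : (ι → Bool) → ℝ) :
    ∃ D, ∀ (g : (ι → Bool) → ℝ) (r : ι → ℝ), (∀ j σ, |g σ - g (flipAt σ j)| ≤ r j) →
      |Cov π f g| ≤ D * ∑ j, r j := by
  refine ⟨∑ σ, π σ * |f σ - Emean π f|, fun g r hg => ?_⟩
  obtain ⟨τ⟩ : Nonempty (ι → Bool) := inferInstance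
  have h : Cov π f g = ∑ σ, π σ * (f σ - Emean π f) * (g σ - g τ) := by
    have e : ∀ σ, π σ * (f σ - Emean π f) * (g σ - g τ) =
        π σ * (f σ * g σ) - Emean π f * (π σ * g σ) - g τ * (π σ * f σ) +
          Emean π f * g τ * π σ := fun σ => by ring
    simp only [e, Finset.sum_add_distrib, Finset.sum_sub_distrib, ← Finset.mul_sum, hsum]
    simp only [Cov, Emean]
    ring
  rw [h, Finset.sum_mul]
  refine (Finset.abs_sum_le_sum_abs _ _).trans (Finset.sum_le_sum fun σ _ => ?_)
  rw [abs_mul, abs_mul, abs_of_pos (hπ σ)]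
  have := hπ σ
  exact mul_le_mul_of_nonneg_left (abs_sub_le_sum_flipAt hg σ τ) (by positivity)

/-- Covariance bound in the Dobrushin uniqueness regime. -/
theorem abs_Cov_le_of_dobrushin [Nonempty ι] {π : (ι → Bool) → ℝ} (hπ : ∀ σ, 0 < π σ)
    (hsum : ∑ σ, π σ = 1) {c : ι → ι → ℝ} {γ : ℝ} (hγ : γ < 1)
    (hc : ∀ i j, j ≠ i → ∀ σ, |condProb π i σ - condProb π i (flipAt σ j)| ≤ c i j)
    (hc0 : ∀ i j, 0 ≤ c i j) (hrow : ∀ i, ∑ j, c i j ≤ γ)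
    {f : (ι → Bool) → ℝ} {C : ℝ} (hf : ∀ i σ, |f σ - f (flipAt σ i)| ≤ C)
    {g : (ι → Bool) → ℝ} {r : ι → ℝ} (hg : ∀ j σ, |g σ - g (flipAt σ j)| ≤ r j) :
    |Cov π f g| ≤ C / (1 - γ) * ∑ j, r j := by
  obtain ⟨D₀, hD₀⟩ := abs_Cov_le_crude hπ hsum f
  obtain ⟨n, hn⟩ : ∃ n : ℝ, n = (Fintype.card ι : ℝ) := ⟨_, rfl⟩
  have hn1 : 1 ≤ n := by
    rw [hn]; exact_mod_cast Fintype.card_pos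
  have hγ0 : 0 ≤ γ :=
    (Finset.sum_nonneg fun j _ => hc0 (Classical.arbitrary ι) j).trans (hrow _)
  have hC : 0 ≤ C := (abs_nonneg _).trans (hf (Classical.arbitrary ι) fun _ => true)
  have hγ' : 0 < 1 - γ := by linarith
  obtain ⟨q, hq⟩ : ∃ q, q = 1 - (1 - γ) / n := ⟨_, rfl⟩
  have hq1 : q < 1 := by rw [hq]; have : 0 < (1 - γ) / n := by positivity
                         linarith
  have hq0 : 0 ≤ q := by
    rw [hq, sub_nonneg, div_le_one (by linarith)]; linarith
  have step : ∀ D : ℝ, 0 ≤ D → (∀ (g : (ι → Bool) → ℝ) (r : ι → ℝ),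
      (∀ j σ, |g σ - g (flipAt σ j)| ≤ r j) → |Cov π f g| ≤ D * ∑ j, r j) →
      ∀ (g : (ι → Bool) → ℝ) (r : ι → ℝ),
      (∀ j σ, |g σ - g (flipAt σ j)| ≤ r j) → |Cov π f g| ≤ (C / n + q * D) * ∑ j, r j := by
    intro D hD0 hD g r hg
    have hr : ∀ j, 0 ≤ r j := fun j => (abs_nonneg _).trans (hg j fun _ => true)
    have hone : ∀ i, |Cov π f g| ≤
        C * r i + D * (∑ j, r j - r i + r i * γ) := by
      intro i
      refine (abs_Cov_le_heatBath hπ hsum i (hf i) (hg i)).trans (add_le_add_right ?_ _)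
      have h1 := hD (heatBath π i g) (fun j => if j = i then 0 else r j + c i j * r i) ?_
      · refine h1.trans (mul_le_mul_of_nonneg_left ?_ hD0)
        have h2 : ∀ j, (if j = i then 0 else r j + c i j * r i) ≤
            r j - (if j = i then r j else 0) + r i * c i j := by
          intro j
          split_ifs
          · have := mul_nonneg (hr i) (hc0 i j); linarith
          · linarith [mul_comm (r i) (c i j)]
        refine (Finset.sum_le_sum fun j _ => h2 j).trans ?_
        rw [Finset.sum_add_distrib, Finset.sum_sub_distrib, ← Finset.mul_sum,
          Finset.sum_ite_eq' Finset.univ i, if_pos (Finset.mem_univ i)]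
        linarith [mul_le_mul_of_nonneg_left (hrow i) (hr i)]
      · intro j σ
        split_ifs with h
        · rw [h, heatBath_flipAt_self]; simp
        · exact heatBath_flipAt_le hπ h hg (hc i j h) σ
    have htot := Finset.sum_le_sum fun i (_ : i ∈ Finset.univ) => hone i
    simp only [Finset.sum_const, Finset.card_univ, nsmul_eq_mul, Finset.sum_add_distrib,
      Finset.sum_sub_distrib, ← Finset.mul_sum, ← Finset.sum_mul, ← hn] at htot
    have : |Cov π f g| ≤ (C * ∑ j, r j + D * (n * ∑ j, r j - ∑ j, r j + (∑ j, r j) * γ)) / n := by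
      rw [le_div_iff₀ (by linarith)]; linarith
    refine this.trans_eq ?_
    rw [hq]; field_simp; ring
  obtain ⟨E, hE⟩ : ∃ E, E = C / (1 - γ) := ⟨_, rfl⟩
  have hE0 : 0 ≤ E := by rw [hE]; positivity
  have hfix : C / n + q * E = E := by rw [hq, hE]; field_simp; ring
  have iter : ∀ k : ℕ, ∀ (g : (ι → Bool) → ℝ) (r : ι → ℝ),
      (∀ j σ, |g σ - g (flipAt σ j)| ≤ r j) →
      |Cov π f g| ≤ (E + q ^ k * |D₀|) * ∑ j, r j := by
    intro k
    induction k with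
    | zero =>
      intro g r hg
      have hr : 0 ≤ ∑ j, r j :=
        Finset.sum_nonneg fun j _ => (abs_nonneg _).trans (hg j fun _ => true)
      refine (hD₀ g r hg).trans (mul_le_mul_of_nonneg_right ?_ hr)
      rw [pow_zero, one_mul]; linarith [le_abs_self D₀]
    | succ k ih =>
      intro g r hg
      refine (step _ (by positivity) ih g r hg).trans_eq ?_
      rw [mul_add, ← add_assoc, hfix, pow_succ]; ring
  rw [← hE]
  have hlim : Filter.Tendsto (fun k : ℕ => (E + q ^ k * |D₀|) * ∑ j, r j) Filter.atTop
      (nhds ((E + 0 * |D₀|) * ∑ j, r j)) :=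
    (((tendsto_pow_atTop_nhds_zero_of_lt_one hq0 hq1).mul_const _).const_add _).mul_const _
  simpa using ge_of_tendsto' hlim fun k => iter k g r hg

end dobrushin

section spinSystem

variable {ι : Type*}

lemma abs_spin (b : Bool) : |spin b| = 1 := by cases b <;> simp [spin]

lemma spin_not (b : Bool) : spin (!b) = -spin b := by cases b <;> simp [spin]

section finite

variable [Fintype ι] {J : ι → ι → ℝ}

/-- The local energy `Σ_j J_{lj} σ_l σ_j` of the spin at `l`. -/
noncomputable def localEnergy (J : ι → ι → ℝ) (l : ι) (σ : ι → Bool) : ℝ :=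
  ∑ j, J l j * spin (σ l) * spin (σ j)

lemma phi_eq (l : ι) (σ : ι → Bool) : phi J l σ = Real.exp (-2 * localEnergy J l σ) := rfl

lemma abs_localEnergy_le {B : ℝ} (hB : ∀ i, ∑ j, |J i j| ≤ B) (l : ι) (σ : ι → Bool) :
    |localEnergy J l σ| ≤ B := by
  refine (Finset.abs_sum_le_sum_abs _ _).trans (le_of_eq_of_le ?_ (hB l))
  simp [abs_mul, abs_spin]

lemma abs_phi_sub_phi_le {B : ℝ} (hB : ∀ i, ∑ j, |J i j| ≤ B) (l : ι) (σ τ : ι → Bool) :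
    |phi J l σ - phi J l τ| ≤
      2 * Real.exp (2 * B) * |localEnergy J l σ - localEnergy J l τ| := by
  have h1 := abs_le.1 (abs_localEnergy_le hB l σ)
  have h2 := abs_le.1 (abs_localEnergy_le hB l τ)
  refine (exp_sub_exp_le_mul (M := 2 * B) ?_ ?_).trans_eq ?_
  · change -2 * localEnergy J l σ ≤ 2 * B
    linarith
  · change -2 * localEnergy J l τ ≤ 2 * B
    linarith
  · change Real.exp (2 * B) * |-2 * localEnergy J l σ - -2 * localEnergy J l τ| = _
    rw [← mul_sub, abs_mul]
    norm_num
    ring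

lemma abs_log_one_add_phi_sub_le {B t : ℝ} (ht : 0 ≤ t) (hB : ∀ i, ∑ j, |J i j| ≤ B) (l : ι)
    (σ τ : ι → Bool) :
    |Real.log (1 + t * phi J l σ) - Real.log (1 + t * phi J l τ)| ≤
      t * (2 * Real.exp (2 * B) * |localEnergy J l σ - localEnergy J l τ|) := by
  have hφ : ∀ σ, 0 ≤ t * phi J l σ := fun σ => mul_nonneg ht (Real.exp_pos _).le
  refine (abs_log_sub_log_le (by linarith [hφ σ]) (by linarith [hφ τ])).trans ?_
  rw [add_sub_add_left_eq_sub, ← mul_sub, abs_mul, abs_of_nonneg ht]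
  exact mul_le_mul_of_nonneg_left (abs_phi_sub_phi_le hB l σ τ) ht

lemma fδ_pos {t : ℝ} (ht : 0 ≤ t) (σ : ι → Bool) : 0 < fδ J t σ :=
  Finset.prod_pos fun _ _ =>
    add_pos_of_pos_of_nonneg one_pos (mul_nonneg ht (Real.exp_pos _).le)

/-- Log-density of the measure proportional to `e^{-H} f_t ^ k`. -/
noncomputable def logDensity (J : ι → ι → ℝ) (t : ℝ) (k : ℕ) (σ : ι → Bool) : ℝ :=
  ∑ l, localEnergy J l σ + k * ∑ l, Real.log (1 + t * phi J l σ)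

lemma exp_logDensity {t : ℝ} (ht : 0 ≤ t) (k : ℕ) (σ : ι → Bool) :
    Real.exp (logDensity J t k σ) = Real.exp (-Ham J σ) * fδ J t σ ^ k := by
  have hφ : ∀ l, 0 < 1 + t * phi J l σ := fun l =>
    add_pos_of_pos_of_nonneg one_pos (mul_nonneg ht (Real.exp_pos _).le)
  have hH : -Ham J σ = ∑ l, localEnergy J l σ := by simp only [Ham, localEnergy, neg_neg]
  rw [logDensity, Real.exp_add, Real.exp_nat_mul, hH,
    Real.exp_sum Finset.univ fun l => Real.log (1 + t * phi J l σ)]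
  simp only [Real.exp_log (hφ _)]
  rfl

end finite

variable [DecidableEq ι]

lemma flipAt_apply (σ : ι → Bool) (j l : ι) : flipAt σ j l = if l = j then !σ j else σ l := by
  simp [flipAt, Function.update_apply]

lemma spin_flipAt (σ : ι → Bool) (j l : ι) :
    spin (flipAt σ j l) = if l = j then -spin (σ j) else spin (σ l) := by
  rw [flipAt_apply]; split_ifs <;> simp [spin_not]

lemma flipAt_comm {i j : ι} (h : j ≠ i) (σ : ι → Bool) :
    flipAt (flipAt σ i) j = flipAt (flipAt σ j) i := by
  funext l
  simp only [flipAt_apply, if_neg h, if_neg h.symm]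
  by_cases h1 : l = i <;> by_cases h2 : l = j <;> simp_all

lemma condProb_eq_logistic {π E : (ι → Bool) → ℝ} {c : ℝ} (hc : 0 < c)
    (hπ : ∀ σ, π σ = c * Real.exp (E σ)) (i : ι) (σ : ι → Bool) :
    condProb π i σ = 1 / (1 + Real.exp
      (-(E (Function.update σ i true) - E (Function.update σ i false)))) := by
  have h : Real.exp (E (Function.update σ i false)) = Real.exp (E (Function.update σ i true)) *
      Real.exp (-(E (Function.update σ i true) - E (Function.update σ i false))) := by
    rw [← Real.exp_add]; ring_nf
  rw [condProb, hπ, hπ, h]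
  have := Real.exp_pos (E (Function.update σ i true))
  field_simp

variable [Fintype ι] {J : ι → ι → ℝ}

lemma localEnergy_flipAt_of_ne {l j : ι} (h : l ≠ j) (σ : ι → Bool) :
    localEnergy J l (flipAt σ j) =
      localEnergy J l σ + -2 * (J l j * spin (σ l) * spin (σ j)) := by
  unfold localEnergy
  have e : ∀ m, J l m * spin (flipAt σ j l) * spin (flipAt σ j m) =
      J l m * spin (σ l) * spin (σ m) +
        if m = j then -2 * (J l j * spin (σ l) * spin (σ j)) else 0 := by
    intro m
    rw [spin_flipAt, spin_flipAt, if_neg h]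
    split_ifs with hm
    · subst hm; ring
    · ring
  simp only [e, Finset.sum_add_distrib, Finset.sum_ite_eq', Finset.mem_univ, if_true]

lemma localEnergy_flipAt_self (hdiag : ∀ i, J i i = 0) (l : ι) (σ : ι → Bool) :
    localEnergy J l (flipAt σ l) = -localEnergy J l σ := by
  unfold localEnergy
  rw [← Finset.sum_neg_distrib]
  refine Finset.sum_congr rfl fun m _ => ?_
  rw [spin_flipAt, spin_flipAt, if_pos rfl]
  split_ifs with hm
  · subst hm; rw [hdiag]; ring
  · ring

lemma abs_localEnergy_sub_flipAt {l j : ι} (h : l ≠ j) (σ : ι → Bool) :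
    |localEnergy J l σ - localEnergy J l (flipAt σ j)| = 2 * |J l j| := by
  rw [localEnergy_flipAt_of_ne h, sub_add_cancel_left, abs_neg]
  simp [abs_mul, abs_spin]

lemma localEnergy_mixed (hsym : ∀ i j, J i j = J j i) (hdiag : ∀ i, J i i = 0) {i j : ι}
    (hij : j ≠ i) (l : ι) (τ : ι → Bool) :
    localEnergy J l τ - localEnergy J l (flipAt τ i) -
        (localEnergy J l (flipAt τ j) - localEnergy J l (flipAt (flipAt τ j) i)) =
      (if l = i then 4 * (J i j * spin (τ i) * spin (τ j)) else 0) +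
        (if l = j then 4 * (J i j * spin (τ i) * spin (τ j)) else 0) := by
  by_cases hi : l = i
  · subst hi
    rw [if_pos rfl, if_neg hij.symm, localEnergy_flipAt_self hdiag, localEnergy_flipAt_self hdiag,
      localEnergy_flipAt_of_ne hij.symm]
    ring
  · by_cases hj : l = j
    · subst hj
      rw [if_neg hi, if_pos rfl, ← flipAt_comm hij, localEnergy_flipAt_self hdiag,
        localEnergy_flipAt_self hdiag, localEnergy_flipAt_of_ne hi, hsym i l]
      ring
    · rw [if_neg hi, if_neg hj, localEnergy_flipAt_of_ne hi, localEnergy_flipAt_of_ne hi,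
        localEnergy_flipAt_of_ne hj, spin_flipAt, spin_flipAt, if_neg hj, if_neg hij.symm]
      ring

lemma abs_log_one_add_phi_mixed_le (hsym : ∀ i j, J i j = J j i) {B t : ℝ} (hB0 : 0 ≤ B)
    (ht : 0 ≤ t) (hB : ∀ i, ∑ j, |J i j| ≤ B) {i j : ι} (hij : j ≠ i) (l : ι) (τ : ι → Bool) :
    |Real.log (1 + t * phi J l τ) - Real.log (1 + t * phi J l (flipAt τ i)) -
        (Real.log (1 + t * phi J l (flipAt τ j)) -
          Real.log (1 + t * phi J l (flipAt (flipAt τ j) i)))| ≤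
      t * (16 * Real.exp (10 * B)) * ((if l = i then |J i j| else 0) +
        (if l = j then |J i j| else 0) + |J l i| * |J l j|) := by
  have hexp : Real.exp (2 * B) ≤ Real.exp (10 * B) := Real.exp_le_exp.2 (by linarith)
  have hJB : ∀ a b, |J a b| ≤ B := fun a b =>
    (Finset.single_le_sum (f := fun m => |J a m|) (fun m _ => abs_nonneg _)
      (Finset.mem_univ b)).trans (hB a)
  have hfirst : t * (2 * Real.exp (2 * B) * (2 * |J i j|)) +
      t * (2 * Real.exp (2 * B) * (2 * |J i j|)) ≤ t * (16 * Real.exp (10 * B)) * |J i j| := by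
    have h1 := mul_le_mul_of_nonneg_left hexp (mul_nonneg ht (abs_nonneg (J i j)))
    have h2 : 0 ≤ t * |J i j| * Real.exp (10 * B) := by positivity
    linarith
  by_cases hi : l = i
  · subst hi
    have e := abs_sub (Real.log (1 + t * phi J l τ) - Real.log (1 + t * phi J l (flipAt τ j)))
      (Real.log (1 + t * phi J l (flipAt τ l)) -
        Real.log (1 + t * phi J l (flipAt (flipAt τ l) j)))
    have h1 := abs_log_one_add_phi_sub_le ht hB l τ (flipAt τ j)
    have h2 := abs_log_one_add_phi_sub_le ht hB l (flipAt τ l) (flipAt (flipAt τ l) j)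
    rw [abs_localEnergy_sub_flipAt hij.symm] at h1 h2
    have h3 : 0 ≤ t * (16 * Real.exp (10 * B)) * (|J l l| * |J l j|) := by positivity
    rw [if_pos rfl, if_neg hij.symm, ← flipAt_comm hij, sub_sub_sub_comm, mul_add, add_zero]
    linarith
  · by_cases hj : l = j
    · subst hj
      have e := abs_sub (Real.log (1 + t * phi J l τ) - Real.log (1 + t * phi J l (flipAt τ i)))
        (Real.log (1 + t * phi J l (flipAt τ l)) -
          Real.log (1 + t * phi J l (flipAt (flipAt τ l) i)))
      have h1 := abs_log_one_add_phi_sub_le ht hB l τ (flipAt τ i)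
      have h2 := abs_log_one_add_phi_sub_le ht hB l (flipAt τ l) (flipAt (flipAt τ l) i)
      rw [abs_localEnergy_sub_flipAt hi, hsym l i] at h1 h2
      have h3 : 0 ≤ t * (16 * Real.exp (10 * B)) * (|J l i| * |J l l|) := by positivity
      rw [if_pos rfl, if_neg hi, mul_add, zero_add]
      linarith
    · have hα : |-2 * (J l i * spin (τ l) * spin (τ i))| ≤ 2 * |J l i| := by
        simp [abs_mul, abs_spin]
      have hβ : |-2 * (J l j * spin (τ l) * spin (τ j))| ≤ 2 * |J l j| := by
        simp [abs_mul, abs_spin]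
      have h := log_second_difference_le ht (abs_localEnergy_le hB l τ) hα hβ (hJB l i) (hJB l j)
      have e1 : localEnergy J l (flipAt (flipAt τ j) i) = localEnergy J l τ +
          -2 * (J l i * spin (τ l) * spin (τ i)) + -2 * (J l j * spin (τ l) * spin (τ j)) := by
        rw [localEnergy_flipAt_of_ne hi, localEnergy_flipAt_of_ne hj, spin_flipAt, spin_flipAt,
          if_neg hj, if_neg hij.symm]
        ring
      rw [← e1, ← localEnergy_flipAt_of_ne hi, ← localEnergy_flipAt_of_ne hj] at h
      simp only [← phi_eq] at h
      rw [if_neg hi, if_neg hj, zero_add, zero_add]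
      refine le_of_eq_of_le ?_ h
      congr 1
      ring

lemma condProb_sub_flipAt_le (hsym : ∀ i j, J i j = J j i) (hdiag : ∀ i, J i i = 0) {B t : ℝ}
    (hB0 : 0 ≤ B) (ht : 0 ≤ t) (hB : ∀ i, ∑ j, |J i j| ≤ B) {k : ℕ} (hk : k ≤ 2)
    {π : (ι → Bool) → ℝ} {c : ℝ} (hc : 0 < c)
    (hπ : ∀ σ, π σ = c * Real.exp (logDensity J t k σ)) {i j : ι} (hij : j ≠ i)
    (σ : ι → Bool) :
    |condProb π i σ - condProb π i (flipAt σ j)| ≤ Real.tanh (2 * |J i j|) +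
      t * (16 * Real.exp (10 * B)) * (2 * |J i j| + ∑ l, |J l i| * |J l j|) := by
  rw [condProb_eq_logistic hc hπ, condProb_eq_logistic hc hπ, flipAt_update_comm hij,
    flipAt_update_comm hij]
  obtain ⟨τ, hτ⟩ : ∃ τ, τ = Function.update σ i true := ⟨_, rfl⟩
  have hτi : Function.update σ i false = flipAt τ i := by simp [hτ, flipAt]
  rw [hτi, ← hτ, flipAt_comm hij]
  have hlin := Finset.sum_congr rfl fun l (_ : l ∈ Finset.univ) =>
    localEnergy_mixed hsym hdiag hij l τ
  have hpert := (Finset.abs_sum_le_sum_abs _ _).trans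
    (Finset.sum_le_sum fun l (_ : l ∈ Finset.univ) =>
      abs_log_one_add_phi_mixed_le hsym hB0 ht hB hij l τ)
  simp only [Finset.sum_add_distrib, Finset.sum_sub_distrib, ← Finset.mul_sum,
    Finset.sum_ite_eq', Finset.mem_univ, if_true] at hlin hpert
  unfold logDensity
  generalize ∑ l, localEnergy J l τ = a₁ at *
  generalize ∑ l, localEnergy J l (flipAt τ i) = a₂ at *
  generalize ∑ l, localEnergy J l (flipAt τ j) = a₃ at *
  generalize ∑ l, localEnergy J l (flipAt (flipAt τ j) i) = a₄ at *
  generalize ∑ l, Real.log (1 + t * phi J l τ) = b₁ at *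
  generalize ∑ l, Real.log (1 + t * phi J l (flipAt τ i)) = b₂ at *
  generalize ∑ l, Real.log (1 + t * phi J l (flipAt τ j)) = b₃ at *
  generalize ∑ l, Real.log (1 + t * phi J l (flipAt (flipAt τ j) i)) = b₄ at *
  have h1 := logistic_sub_le_tanh (a₁ + k * b₁ - (a₂ + k * b₂)) (a₃ - a₄ + k * (b₁ - b₂))
  have h2 := logistic_sub_le_tanh (a₃ - a₄ + k * (b₁ - b₂)) (a₃ + k * b₃ - (a₄ + k * b₄))
  have e1 : a₁ + k * b₁ - (a₂ + k * b₂) - (a₃ - a₄ + k * (b₁ - b₂)) =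
      8 * (J i j * spin (τ i) * spin (τ j)) := by linarith
  have e2 : a₃ - a₄ + k * (b₁ - b₂) - (a₃ + k * b₃ - (a₄ + k * b₄)) =
      k * (b₁ - b₂ - (b₃ - b₄)) := by ring
  have e3 : |8 * (J i j * spin (τ i) * spin (τ j))| / 4 = 2 * |J i j| := by
    simp only [abs_mul, abs_spin]; norm_num; ring
  rw [e1, e3] at h1
  rw [e2] at h2
  have h3 : |k * (b₁ - b₂ - (b₃ - b₄))| ≤ 2 * |b₁ - b₂ - (b₃ - b₄)| := by
    rw [abs_mul, Nat.abs_cast]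
    exact mul_le_mul_of_nonneg_right (by exact_mod_cast hk) (abs_nonneg _)
  have h4 := tanh_le_two_mul (div_nonneg (abs_nonneg (k * (b₁ - b₂ - (b₃ - b₄)))) zero_le_four)
  refine (abs_sub_le _ _ _).trans (add_le_add h1 (h2.trans (h4.trans ?_)))
  linarith

lemma abs_Gsum_sub_flipAt_le (hsym : ∀ i j, J i j = J j i) {B t : ℝ} (ht : 0 ≤ t)
    (hB : ∀ i, ∑ j, |J i j| ≤ B) (j : ι) (σ : ι → Bool) :
    |Gsum J t σ - Gsum J t (flipAt σ j)| ≤ 8 * B * Real.exp (2 * B) := by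
  have hterm : ∀ l, |phi J l σ / (1 + t * phi J l σ) -
      phi J l (flipAt σ j) / (1 + t * phi J l (flipAt σ j))| ≤
        2 * Real.exp (2 * B) * ((if l = j then 2 * B else 0) + 2 * |J l j|) := by
    intro l
    have hp : 0 < phi J l σ := Real.exp_pos _
    have hq : 0 < phi J l (flipAt σ j) := Real.exp_pos _
    have hφ := abs_phi_sub_phi_le hB l σ (flipAt σ j)
    have hE : |localEnergy J l σ - localEnergy J l (flipAt σ j)| ≤
        (if l = j then 2 * B else 0) + 2 * |J l j| := by
      split_ifs with h
      · have h1 := abs_localEnergy_le hB l σ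
        have h2 := abs_localEnergy_le hB l (flipAt σ j)
        have h3 := abs_sub (localEnergy J l σ) (localEnergy J l (flipAt σ j))
        linarith [abs_nonneg (J l j)]
      · rw [abs_localEnergy_sub_flipAt h, zero_add]
    refine le_trans ?_ (hφ.trans (mul_le_mul_of_nonneg_left hE (by positivity)))
    generalize phi J l σ = p at *
    generalize phi J l (flipAt σ j) = q at *
    have e : p / (1 + t * p) - q / (1 + t * q) = (p - q) / ((1 + t * p) * (1 + t * q)) := by
      field_simp; ring
    rw [e, abs_div]
    refine div_le_self (abs_nonneg _) ?_
    rw [abs_of_pos (by positivity)]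
    nlinarith [mul_nonneg ht hp.le, mul_nonneg ht hq.le,
      mul_nonneg (mul_nonneg ht hp.le) (mul_nonneg ht hq.le)]
  unfold Gsum
  rw [← Finset.sum_sub_distrib]
  refine (Finset.abs_sum_le_sum_abs _ _).trans
    ((Finset.sum_le_sum fun l _ => hterm l).trans ?_)
  simp only [← Finset.mul_sum, Finset.sum_add_distrib, Finset.sum_ite_eq', Finset.mem_univ,
    if_true]
  have hcol : ∑ l, |J l j| ≤ B := by simpa only [hsym _ j] using hB j
  have := mul_le_mul_of_nonneg_left hcol (Real.exp_pos (2 * B)).le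
  linarith

lemma Var_eq_Cov {α : Type*} [Fintype α] (π g : α → ℝ) : Var π g = Cov π g g := by
  simp only [Var, Cov, sq]

theorem Var_Gsum_le [Nonempty ι] (hsym : ∀ i j, J i j = J j i) (hdiag : ∀ i, J i i = 0)
    {B t γ : ℝ} (hB0 : 0 ≤ B) (ht : 0 ≤ t) (hB : ∀ i, ∑ j, |J i j| ≤ B)
    (hγ : ∀ i, ∑ j, Real.tanh (2 * |J i j|) ≤ γ) (hγ1 : γ < 1)
    (hsmall : t * (16 * Real.exp (10 * B) * (2 * B + B * B)) ≤ (1 - γ) / 2)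
    {k : ℕ} (hk : k ≤ 2) {π : (ι → Bool) → ℝ} {c : ℝ} (hc : 0 < c)
    (hπ : ∀ σ, π σ = c * (Real.exp (-Ham J σ) * fδ J t σ ^ k)) (hsum : ∑ σ, π σ = 1) :
    1 / (Fintype.card ι : ℝ) * Var π (Gsum J t) ≤
      (8 * B * Real.exp (2 * B)) ^ 2 / ((1 - γ) / 2) := by
  simp only [← exp_logDensity ht] at hπ
  have hpos : ∀ σ, 0 < π σ := fun σ => by rw [hπ]; exact mul_pos hc (Real.exp_pos _)
  have hn : (0 : ℝ) < Fintype.card ι := by exact_mod_cast Fintype.card_pos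
  have hrow : ∀ i, ∑ j, (Real.tanh (2 * |J i j|) +
      t * (16 * Real.exp (10 * B)) * (2 * |J i j| + ∑ l, |J l i| * |J l j|)) ≤ (1 + γ) / 2 := by
    intro i
    have hquad : ∑ j, ∑ l, |J l i| * |J l j| ≤ B * B := by
      rw [Finset.sum_comm]
      simp only [← Finset.mul_sum]
      refine (Finset.sum_le_sum fun l _ =>
        mul_le_mul_of_nonneg_left (hB l) (abs_nonneg _)).trans ?_
      rw [← Finset.sum_mul]
      refine mul_le_mul_of_nonneg_right ?_ hB0
      simpa only [hsym _ i] using hB i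
    simp only [Finset.sum_add_distrib, ← Finset.mul_sum]
    have h2 : 2 * ∑ j, |J i j| + ∑ j, ∑ l, |J l i| * |J l j| ≤ 2 * B + B * B := by
      linarith [hB i]
    have h3 := mul_le_mul_of_nonneg_left h2
      (by positivity : 0 ≤ t * (16 * Real.exp (10 * B)))
    linarith [hγ i]
  have htanh : ∀ i j, 0 ≤ Real.tanh (2 * |J i j|) := fun i j =>
    tanh_nonneg_of_nonneg (by positivity)
  have hcov := abs_Cov_le_of_dobrushin hpos hsum (by linarith : (1 + γ) / 2 < 1)
    (fun i j hij σ => condProb_sub_flipAt_le hsym hdiag hB0 ht hB hk hc hπ hij σ)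
    (fun i j => add_nonneg (htanh i j) (by positivity)) hrow
    (abs_Gsum_sub_flipAt_le hsym ht hB) (abs_Gsum_sub_flipAt_le hsym ht hB)
  rw [Finset.sum_const, Finset.card_univ, nsmul_eq_mul, ← Var_eq_Cov] at hcov
  rw [one_div, inv_mul_le_iff₀ hn]
  refine (le_abs_self _).trans (hcov.trans_eq ?_)
  rw [show 1 - (1 + γ) / 2 = (1 - γ) / 2 by ring]
  ring

end spinSystem

section normalization

variable {ι : Type*} [Fintype ι] [DecidableEq ι] {J : ι → ι → ℝ} {t : ℝ}

lemma piG_pos (σ : ι → Bool) : 0 < piG J σ :=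
  div_pos (Real.exp_pos _) (Finset.sum_pos (fun _ _ => Real.exp_pos _) Finset.univ_nonempty)

/-- A reweighting of `π^G` by `f_t ^ k` is a probability with density proportional to
`e^{-H} f_t ^ k`. -/
lemma reweighted_spec (ht : 0 ≤ t) (k : ℕ) {π : (ι → Bool) → ℝ}
    (hπ : ∀ σ, π σ = piG J σ * fδ J t σ ^ k / Emean (piG J) (fun τ => fδ J t τ ^ k)) :
    ∑ σ, π σ = 1 ∧
      ∃ c > 0, ∀ σ, π σ = c * (Real.exp (-Ham J σ) * fδ J t σ ^ k) := by
  have hE : 0 < Emean (piG J) (fun τ => fδ J t τ ^ k) :=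
    Finset.sum_pos (fun σ _ => mul_pos (piG_pos σ) (pow_pos (fδ_pos ht σ) k))
      Finset.univ_nonempty
  have hZ : 0 < ∑ τ : ι → Bool, Real.exp (-Ham J τ) :=
    Finset.sum_pos (fun _ _ => Real.exp_pos _) Finset.univ_nonempty
  constructor
  · simp only [hπ, ← Finset.sum_div]
    exact div_self hE.ne'
  · refine ⟨1 / ((∑ τ : ι → Bool, Real.exp (-Ham J τ)) *
      Emean (piG J) (fun τ => fδ J t τ ^ k)), by positivity, fun σ => ?_⟩
    rw [hπ, piG]
    field_simp

end normalization

/-- Under the Dobrushin-type condition `sup_i Σ_j tanh(2|J_{ij}|) < 1`, there is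
`δ₀ > 0` such that `(1/|V|) Var_π[Σ_{i∈V} φ_i/(1+δφ_i)]` is bounded uniformly over all finite
volumes `V` and all `δ ∈ [0,δ₀]`, both for `π = π^{PCA}` and `π = π̃`. -/
theorem variance_bound_of_dobrushin {d : ℕ}
    (J : (Fin d → ℤ) → (Fin d → ℤ) → ℝ)
    (hsym : ∀ i j, J i j = J j i)
    (hdiag : ∀ i, J i i = 0)
    (hsumm : ∀ i, Summable fun j => |J i j|)
    (Jbar : ℝ) (hJbar : ∀ i, ∑' j, |J i j| ≤ Jbar)
    (hsummt : ∀ i, Summable fun j => Real.tanh (2 * |J i j|))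
    (hdob : ∃ γ < (1 : ℝ), ∀ i, ∑' j, Real.tanh (2 * |J i j|) ≤ γ) :
    ∃ δ₀ > (0 : ℝ), ∃ M : ℝ, ∀ V : Finset (Fin d → ℤ), ∀ t ∈ Set.Icc (0 : ℝ) δ₀,
      (1 / (V.card : ℝ)) * Var (piPCA (Jres J V) t) (Gsum (Jres J V) t) ≤ M ∧
      (1 / (V.card : ℝ)) * Var (piTilde (Jres J V) t) (Gsum (Jres J V) t) ≤ M := by
  obtain ⟨γ, hγ1, hγ⟩ := hdob
  obtain ⟨B, hB⟩ : ∃ B, B = max Jbar 0 := ⟨_, rfl⟩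
  have hB0 : 0 ≤ B := hB ▸ le_max_right _ _
  obtain ⟨K, hK⟩ : ∃ K, K = 16 * Real.exp (10 * B) * (2 * B + B * B) := ⟨_, rfl⟩
  have hK0 : 0 ≤ K := by rw [hK]; positivity
  have hγ' : 0 < (1 - γ) / 2 := by linarith
  refine ⟨(1 - γ) / 2 / (K + 1), by positivity,
    (8 * B * Real.exp (2 * B)) ^ 2 / ((1 - γ) / 2), fun V t ht => ?_⟩
  rcases V.eq_empty_or_nonempty with rfl | hV
  · simp only [Finset.card_empty, Nat.cast_zero, div_zero, zero_mul, and_self]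
    positivity
  have : Nonempty ↥V := hV.to_subtype
  have hrow : ∀ i : ↥V, ∑ j, |Jres J V i j| ≤ B := by
    intro i
    have h : ∑ j : ↥V, |J i j| ≤ ∑' j, |J i j| := by
      rw [Finset.sum_coe_sort V fun j => |J i j|]
      exact (hsumm i).sum_le_tsum V fun j _ => abs_nonneg _
    exact h.trans ((hJbar i).trans (hB ▸ le_max_left _ _))
  have htanh : ∀ i : ↥V, ∑ j, Real.tanh (2 * |Jres J V i j|) ≤ γ := by
    intro i
    have h : ∑ j : ↥V, Real.tanh (2 * |J i j|) ≤ ∑' j, Real.tanh (2 * |J i j|) := by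
      rw [Finset.sum_coe_sort V fun j => Real.tanh (2 * |J i j|)]
      exact (hsummt i).sum_le_tsum V fun j _ => tanh_nonneg_of_nonneg (by positivity)
    exact h.trans (hγ i)
  have hsmall : t * (16 * Real.exp (10 * B) * (2 * B + B * B)) ≤ (1 - γ) / 2 := by
    rw [← hK]
    have h := (le_div_iff₀ (by linarith)).1 ht.2
    linarith [ht.1]
  have key : ∀ k ≤ 2, ∀ π : (↥V → Bool) → ℝ, (∀ σ, π σ = piG (Jres J V) σ *
      fδ (Jres J V) t σ ^ k / Emean (piG (Jres J V)) (fun τ => fδ (Jres J V) t τ ^ k)) →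
      1 / (V.card : ℝ) * Var π (Gsum (Jres J V) t) ≤
        (8 * B * Real.exp (2 * B)) ^ 2 / ((1 - γ) / 2) := by
    intro k hk π hπ
    obtain ⟨hsum, c, hc, hdens⟩ := reweighted_spec ht.1 k hπ
    rw [← Fintype.card_coe V]
    exact Var_Gsum_le (J := Jres J V) (fun i j => hsym i j) (fun i => hdiag i) hB0 ht.1 hrow htanh hγ1 hsmall hk
      hc hdens hsum
  exact ⟨key 1 one_le_two _ fun σ => by simp only [pow_one]; rfl, key 2 le_rfl _ fun σ => rfl⟩
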